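/- Let D ⊆ ℂ be a bounded Jordan domain, z ∈ D, and φ : 𝔻 → D the conformal map with φ(0) = z, φ'(0) > 0. Let X ⊆ ∂D be closed with upper Minkowski dimension at most d ∈ (0,2), and suppose there is δ ∈ (0,1) such that φ restricted to W = {w ∈ 𝔻 : dist(w, φ^{-1}(X)) < δ} is β-Hölder for some β ∈ (0,1). Let 𝒲 be a Whitney square decomposition of D and 𝒲_j the set of squares Q ∈ 𝒲 with side length 2^{−j} that are hit by some hyperbolic geodesic in D from z to a point of X. Then for every a ∈ (0,1) there is a constant c = c(a, β, δ, X, D, z) > 0 with |𝒲_j| ≤ c · 2^{(d+a)j} for all j ∈ ℕ. -/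

import Mathlib

open Complex Metric Set Filter Topology
open scoped NNReal ENNReal

/-- The closed axis-parallel square with center `c` and side length `l`. -/
def squareSet (c : ℂ) (l : ℝ) : Set ℂ :=
  {w : ℂ | |w.re - c.re| ≤ l / 2 ∧ |w.im - c.im| ≤ l / 2}

/-- A Whitney square decomposition of an open set `D ⊆ ℂ`: a collection of squares
(encoded as center/side-length pairs) with pairwise disjoint interiors covering `D`, whose
side lengths are comparable to their distance to `∂D`. -/
structure IsWhitneyDecomposition (D : Set ℂ) (𝒲 : Set (ℂ × ℝ)) : Prop where
  len_pos : ∀ q ∈ 𝒲, 0 < q.2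
  sq_subset : ∀ q ∈ 𝒲, squareSet q.1 q.2 ⊆ D
  covers : D ⊆ ⋃ q ∈ 𝒲, squareSet q.1 q.2
  disj : ∀ q ∈ 𝒲, ∀ q' ∈ 𝒲, q ≠ q' →
    Disjoint (interior (squareSet q.1 q.2)) (interior (squareSet q'.1 q'.2))
  comparable : ∀ q ∈ 𝒲,
    q.2 ≤ Metric.infDist q.1 Dᶜ ∧ Metric.infDist q.1 Dᶜ ≤ 8 * q.2

/-- The minimal number of `ε`-balls needed to cover `X`, as an extended nonnegative real. -/
noncomputable def coverNum (X : Set ℂ) (ε : ℝ) : ℝ≥0∞ :=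
  sInf {n : ℝ≥0∞ | ∃ s : Finset ℂ, (s.card : ℝ≥0∞) = n ∧
    X ⊆ ⋃ x ∈ s, Metric.ball x ε}

theorem nhds_le_map_of_injOn {f : ℂ → ℂ} {U : Set ℂ} (hU : IsOpen U)
    (hf : DifferentiableOn ℂ f U) (hinj : InjOn f U) {w : ℂ} (hw : w ∈ U) :
    𝓝 (f w) ≤ map f (𝓝 w) := by
  refine (hf.analyticAt (hU.mem_nhds hw)).eventually_constant_or_nhds_le_map_nhds.resolve_left
    fun h => ?_
  have h2 : ∀ᶠ u in 𝓝 w, u = w := by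
    filter_upwards [h, hU.mem_nhds hw] with u hu huU using hinj huU hw hu
  have h3 : ∀ᶠ u in 𝓝[≠] w, False := by
    filter_upwards [h2.filter_mono nhdsWithin_le_nhds, self_mem_nhdsWithin] with u hu hu'
      using hu' hu
  exact (NeBot.ne inferInstance : 𝓝[≠] w ≠ ⊥) (by simpa using h3)

/-- A left inverse of an injective holomorphic function is holomorphic on its image. -/
theorem differentiableOn_leftInv_of_injOn {f g : ℂ → ℂ} {U : Set ℂ} (hU : IsOpen U)
    (hf : DifferentiableOn ℂ f U) (hinj : InjOn f U) (hg : ∀ w ∈ U, g (f w) = w) :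
    DifferentiableOn ℂ g (f '' U) := by
  have hcont : ∀ w ∈ U, ContinuousAt g (f w) := by
    intro w hw
    have h1 : Tendsto g (map f (𝓝 w)) (𝓝 w) := by
      rw [tendsto_map'_iff]
      refine tendsto_id.congr' ?_
      filter_upwards [hU.mem_nhds hw] with u hu using (hg u hu).symm
    have := h1.mono_left (nhds_le_map_of_injOn hU hf hinj hw)
    rwa [ContinuousAt, hg w hw]
  have himg : ∀ w ∈ U, f '' U ∈ 𝓝 (f w) := fun w hw =>
    nhds_le_map_of_injOn hU hf hinj hw (image_mem_map (hU.mem_nhds hw))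
  have hdiff : ∀ w ∈ U, deriv f w ≠ 0 → DifferentiableAt ℂ g (f w) := by
    intro w hw h0
    refine (HasDerivAt.of_local_left_inverse (f := f) (f' := deriv f w) (hcont w hw) ?_ h0
      ?_).differentiableAt
    · rw [hg w hw]
      exact (hf.differentiableAt (hU.mem_nhds hw)).hasDerivAt
    · filter_upwards [himg w hw]
      rintro _ ⟨u, hu, rfl⟩
      rw [hg u hu]
  rintro _ ⟨w, hw, rfl⟩
  refine DifferentiableAt.differentiableWithinAt
    (analyticAt_of_differentiable_on_punctured_nhds_of_continuousAt ?_ (hcont w hw)).differentiableAt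
  have hne : ∀ᶠ u in 𝓝[≠] w, deriv f u ≠ 0 := by
    refine ((hf.analyticAt (hU.mem_nhds hw)).deriv.eventually_eq_zero_or_eventually_ne_zero
      ).resolve_left fun h => ?_
    obtain ⟨r, hr, hr'⟩ := Metric.eventually_nhds_iff_ball.1 (h.and (hU.mem_nhds hw))
    have hwr : w ∈ ball w r := mem_ball_self hr
    have hw2 : w + (r / 2 : ℝ) ∈ ball w r := by
      rw [mem_ball, dist_eq_norm, add_sub_cancel_left, norm_real, Real.norm_of_nonneg (by positivity)]
      linarith
    have := isOpen_ball.is_const_of_deriv_eq_zero (convex_ball w r).isPreconnected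
      (hf.mono fun u hu => (hr' u hu).2) (fun u hu => (hr' u hu).1) hw2 hwr
    have := hinj (hr' _ hw2).2 hw this
    have h4 : ((r / 2 : ℝ) : ℂ) = 0 := by simpa using this
    rw [ofReal_eq_zero] at h4
    linarith
  have hT : Tendsto g (𝓝[≠] (f w)) (𝓝[≠] w) := by
    refine tendsto_nhdsWithin_iff.2 ⟨?_, ?_⟩
    · have := hcont w hw
      rw [ContinuousAt, hg w hw] at this
      exact this.mono_left nhdsWithin_le_nhds
    · filter_upwards [self_mem_nhdsWithin, nhdsWithin_le_nhds (himg w hw)]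
      rintro _ hu ⟨u, hu', rfl⟩ h
      rw [hg u hu', mem_singleton_iff] at h
      exact hu (by rw [h]; rfl)
  filter_upwards [hT.eventually hne, nhdsWithin_le_nhds (himg w hw)]
  rintro _ hu ⟨u, hu', rfl⟩
  rw [hg u hu'] at hu
  exact hdiff u hu' hu

/-- A weak form of **Bloch's theorem**. -/
theorem exists_ball_subset_image {h : ℂ → ℂ} {c : ℂ} {R : ℝ} (hR : 0 < R)
    (hh : DifferentiableOn ℂ h (ball c R)) (h0 : deriv h c ≠ 0) :
    ∃ p, ball p (R * ‖deriv h c‖ / 128) ⊆ h '' ball c R := by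
  have hdh : DifferentiableOn ℂ (deriv h) (ball c R) := hh.deriv isOpen_ball
  have hsub : closedBall c (R / 2) ⊆ ball c R := closedBall_subset_ball (by linarith)
  obtain ⟨v, hv, hmax⟩ := (isCompact_closedBall c (R / 2)).exists_isMaxOn
    (f := fun v => (R / 2 - dist v c) * ‖deriv h v‖)
    ⟨c, mem_closedBall_self (by positivity)⟩
    ((continuousOn_const.sub (continuous_id.dist continuous_const).continuousOn).mul
      (hdh.continuousOn.mono hsub).norm)
  have hmax' : ∀ u ∈ closedBall c (R / 2),
      (R / 2 - dist u c) * ‖deriv h u‖ ≤ (R / 2 - dist v c) * ‖deriv h v‖ := fun u hu => hmax hu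
  have hc := hmax' c (mem_closedBall_self (by positivity))
  rw [dist_self, sub_zero] at hc
  have h0' : 0 < ‖deriv h c‖ := norm_pos_iff.2 h0
  set t := R / 2 - dist v c with ht
  set b := ‖deriv h v‖ with hb
  have hpos : 0 < t * b := lt_of_lt_of_le (by positivity) hc
  have ht0 : 0 ≤ t := by rw [mem_closedBall] at hv; linarith
  have htp : 0 < t := by
    rcases ht0.eq_or_lt with h | h
    · rw [← h] at hpos; simp at hpos
    · exact h
  have hbp : 0 < b := pos_of_mul_pos_right hpos ht0
  have hball : ∀ u ∈ ball v (t / 2), u ∈ closedBall c (R / 2) ∧ ‖deriv h u‖ ≤ 2 * b := by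
    intro u hu
    rw [mem_ball] at hu
    have h1 := dist_triangle u v c
    have h2 : u ∈ closedBall c (R / 2) := by rw [mem_closedBall]; linarith
    refine ⟨h2, ?_⟩
    have h3 := hmax' u h2
    have h4 : t / 2 * ‖deriv h u‖ ≤ (R / 2 - dist u c) * ‖deriv h u‖ := by
      gcongr; linarith
    have h5 : t * ‖deriv h u‖ ≤ t * (2 * b) := by linarith
    exact le_of_mul_le_mul_left h5 htp
  have hsch : ∀ u ∈ ball v (t / 2), dist (deriv h u) (deriv h v) ≤ 3 * b / (t / 2) * dist u v := by
    intro u hu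
    refine dist_le_div_mul_dist_of_mapsTo_ball
      (hdh.mono fun x hx => hsub (hball x hx).1) ?_ hu
    intro x hx
    rw [mem_closedBall, dist_eq_norm]
    have := norm_sub_le (deriv h x) (deriv h v)
    have := (hball x hx).2
    linarith
  have hmv : ∀ u ∈ closedBall v (t / 16), ‖(h u - deriv h v * u) - (h v - deriv h v * v)‖
      ≤ b / 2 * ‖u - v‖ := by
    intro u hu
    have hd : ∀ x ∈ closedBall v (t / 16), HasDerivAt (fun x => h x - deriv h v * x)
        (deriv h x - deriv h v) x := by
      intro x hx
      have hx' : x ∈ ball v (t / 2) := closedBall_subset_ball (by linarith) hx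
      have := (hh.differentiableAt (isOpen_ball.mem_nhds (hsub (hball x hx').1))).hasDerivAt
      have h1 := this.sub ((hasDerivAt_id x).const_mul (deriv h v))
      rw [mul_one] at h1
      exact h1
    refine Convex.norm_image_sub_le_of_norm_hasDerivWithin_le
      (f := fun x => h x - deriv h v * x)
      (fun x hx => (hd x hx).hasDerivWithinAt) ?_ (convex_closedBall v (t / 16))
      (mem_closedBall_self (by positivity)) hu
    intro x hx
    have hx' : x ∈ ball v (t / 2) := closedBall_subset_ball (by linarith) hx
    have h1 := hsch x hx'
    rw [dist_eq_norm] at h1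
    rw [mem_closedBall] at hx
    calc _ ≤ _ := h1
      _ ≤ 3 * b / (t / 2) * (t / 16) := by gcongr
      _ = 3 * b / 8 := by field_simp; ring
      _ ≤ _ := by linarith
  refine ⟨h v, ?_⟩
  have hin : closedBall v (t / 16) ⊆ ball c R := fun x hx =>
    hsub (hball x (closedBall_subset_ball (by linarith) hx)).1
  have key : ball (h v) ((b * t / 32) / 2) ⊆ h '' closedBall v (t / 16) := by
    refine DiffContOnCl.ball_subset_image_closedBall ?_ (by positivity) ?_ ?_
    · refine DifferentiableOn.diffContOnCl (hh.mono ?_)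
      rw [closure_ball _ (by positivity)]
      exact hin
    · intro u hu
      have h1 := hmv u (sphere_subset_closedBall hu)
      rw [mem_sphere, dist_eq_norm] at hu
      have h2 : ‖deriv h v * (u - v)‖ ≤ ‖h u - h v‖ +
          ‖(h u - deriv h v * u) - (h v - deriv h v * v)‖ := by
        have e : deriv h v * (u - v) =
            (h u - h v) - ((h u - deriv h v * u) - (h v - deriv h v * v)) := by ring
        rw [e]
        exact norm_sub_le _ _
      rw [norm_mul, hu] at h2
      rw [hu] at h1
      have : ‖deriv h v‖ * (t / 16) = b * t / 16 := by rw [← hb]; ring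
      linarith
    · intro hev
      have : deriv h v = 0 := by
        have h1 : h =ᶠ[𝓝 v] fun _ => h v := by
          filter_upwards [hev] with u hu
          simpa using hu
        rw [h1.deriv_eq]; simp
      rw [hb, this, norm_zero] at hbp
      exact lt_irrefl _ hbp
  refine (ball_subset_ball ?_).trans (key.trans (image_mono hin))
  have : R / 2 * ‖deriv h c‖ = R * ‖deriv h c‖ / 2 := by ring
  linarith [mul_comm t b]

/-- A **Koebe-type distortion estimate** with a non-optimal absolute constant: an injective
holomorphic function on a disc omitting `q` has comparable distance to `q` on the half disc. -/
theorem koebe_distortion {f : ℂ → ℂ} {c q : ℂ} {R : ℝ}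
    (hf : DifferentiableOn ℂ f (ball c R)) (hinj : InjOn f (ball c R))
    (hq : ∀ u ∈ ball c R, f u ≠ q) {u : ℂ} (hu : dist u c ≤ R / 2) (hR : 0 < R) :
    dist (f u) q ≤ Real.exp 896 * dist (f c) q ∧ dist (f c) q ≤ Real.exp 896 * dist (f u) q := by
  have hcm : c ∈ ball c R := mem_ball_self hR
  have hne : ∀ u ∈ ball c R, f u - q ≠ 0 := fun u hu => sub_ne_zero.2 (hq u hu)
  have hfd : ∀ u ∈ ball c R, HasDerivAt f (deriv f u) u := fun u hu =>
    (hf.differentiableAt (isOpen_ball.mem_nhds hu)).hasDerivAt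
  obtain ⟨H, hHc, hH⟩ := (DifferentiableOn.isExactOn_ball
    (f := fun u => deriv f u / (f u - q))
    ((hf.deriv isOpen_ball).div (hf.sub_const q) hne)).with_val_at c (Complex.log (f c - q))
  have hHd : DifferentiableOn ℂ H (ball c R) := fun u hu =>
    (hH u hu).differentiableAt.differentiableWithinAt
  have hexp : ∀ u ∈ ball c R, Complex.exp (H u) = f u - q := by
    intro u hu
    have hD : ∀ u ∈ ball c R, HasDerivAt (fun u => (f u - q) * Complex.exp (-H u)) 0 u := by
      intro u hu
      have h1 := ((hfd u hu).sub_const q).mul ((hH u hu).neg.cexp)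
      have h2 : deriv f u * Complex.exp (-H u) +
          (f u - q) * (Complex.exp (-H u) * -(deriv f u / (f u - q))) = 0 := by
        have := hne u hu
        field_simp
        ring
      exact h2 ▸ h1
    have := isOpen_ball.is_const_of_deriv_eq_zero (convex_ball c R).isPreconnected
      (fun u hu => (hD u hu).differentiableAt.differentiableWithinAt)
      (fun u hu => (hD u hu).deriv) hu hcm
    simp only [hHc, Complex.exp_neg, Complex.exp_log (hne c hcm)] at this
    rw [mul_inv_cancel₀ (hne c hcm)] at this
    exact (mul_inv_eq_one₀ (Complex.exp_ne_zero _)).1 this |>.symm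
  have hno : ∀ p, ¬ ball p 7 ⊆ H '' ball c R := by
    intro p hp
    obtain ⟨u₁, hu₁, h₁⟩ := hp (mem_ball_self (by norm_num))
    have : p + 2 * Real.pi * I ∈ ball p 7 := by
      rw [mem_ball, dist_eq_norm, add_sub_cancel_left]
      simp only [norm_mul, Complex.norm_I, norm_real, Real.norm_of_nonneg Real.pi_pos.le]
      norm_num
      linarith [Real.pi_lt_d2]
    obtain ⟨u₂, hu₂, h₂⟩ := hp this
    have h3 : Complex.exp (H u₂) = Complex.exp (H u₁) := by
      rw [h₁, h₂, Complex.exp_periodic]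
    rw [hexp _ hu₁, hexp _ hu₂] at h3
    have := hinj hu₂ hu₁ (sub_left_injective h3)
    rw [this, h₁] at h₂
    have h4 : (2 * Real.pi * I : ℂ) = 0 := by
      simpa using h₂.symm
    exact Complex.two_pi_I_ne_zero h4
  have hder : ∀ v ∈ closedBall c (R / 2), ‖deriv H v‖ ≤ 1792 / R := by
    intro v hv
    rw [mem_closedBall] at hv
    have hsub : ball v (R / 2) ⊆ ball c R := ball_subset_ball' (by linarith)
    by_cases h0 : deriv H v = 0
    · rw [h0, norm_zero]; positivity
    obtain ⟨p, hp⟩ := exists_ball_subset_image (by positivity) (hHd.mono hsub) h0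
    by_contra! hlt
    refine hno p ((ball_subset_ball ?_).trans (hp.trans (image_mono hsub)))
    rw [div_lt_iff₀ hR] at hlt
    linarith
  have hdiff : ‖H u - H c‖ ≤ 896 := by
    have := Convex.norm_image_sub_le_of_norm_deriv_le (f := H) (s := closedBall c (R / 2))
      (fun x hx => (hH x (closedBall_subset_ball (by linarith) hx)).differentiableAt) hder
      (convex_closedBall c _) (mem_closedBall_self (by positivity)) (mem_closedBall.2 hu)
    rw [dist_eq_norm] at hu
    calc _ ≤ _ := this
      _ ≤ 1792 / R * (R / 2) := by gcongr
      _ = 896 := by field_simp; norm_num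
  have hub : u ∈ ball c R := by rw [mem_ball]; linarith
  have hre := (abs_le.1 ((abs_re_le_norm (H u - H c)).trans hdiff))
  rw [Complex.sub_re] at hre
  rw [dist_eq_norm, dist_eq_norm, ← hexp u hub, ← hexp c hcm, Complex.norm_exp, Complex.norm_exp,
    ← Real.exp_add, ← Real.exp_add, Real.exp_le_exp, Real.exp_le_exp]
  constructor <;> linarith

/-- The points `p` and `q` of `D` are at comparable distances from the complement of `D`, and
their mutual distance is at most comparable to that. -/
def WhitneyClose (D : Set ℂ) (M : ℝ) (p q : ℂ) : Prop :=
  dist p q ≤ M * infDist p Dᶜ ∧ infDist q Dᶜ ≤ M * infDist p Dᶜ ∧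
    infDist p Dᶜ ≤ M * infDist q Dᶜ

theorem WhitneyClose.refl {D : Set ℂ} {M : ℝ} (hM : 1 ≤ M) (p : ℂ) : WhitneyClose D M p p := by
  have h : 0 ≤ infDist p Dᶜ := infDist_nonneg
  refine ⟨?_, ?_, ?_⟩
  · rw [dist_self]; positivity
  · exact le_mul_of_one_le_left h hM
  · exact le_mul_of_one_le_left h hM

theorem WhitneyClose.trans {D : Set ℂ} {M N : ℝ} {p q r : ℂ} (hM : 0 ≤ M) (hN : 0 ≤ N)
    (h : WhitneyClose D M p q) (h' : WhitneyClose D N q r) :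
    WhitneyClose D (M + M * N) p r := by
  obtain ⟨h1, h2, h3⟩ := h
  obtain ⟨h4, h5, h6⟩ := h'
  have hp : 0 ≤ infDist p Dᶜ := infDist_nonneg
  have hr : 0 ≤ infDist r Dᶜ := infDist_nonneg
  have a1 := dist_triangle p q r
  have a2 := mul_le_mul_of_nonneg_left h2 hN
  have a3 := mul_le_mul_of_nonneg_left h6 hM
  have a4 := mul_nonneg hM hp
  have a5 := mul_nonneg hM hr
  refine ⟨?_, ?_, ?_⟩ <;> linarith

theorem WhitneyClose.symm {D : Set ℂ} {M : ℝ} {p q : ℂ} (hM : 0 ≤ M)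
    (h : WhitneyClose D M p q) : WhitneyClose D (M + M * M) q p := by
  obtain ⟨h1, h2, h3⟩ := h
  have hp : 0 ≤ infDist p Dᶜ := infDist_nonneg
  have hq : 0 ≤ infDist q Dᶜ := infDist_nonneg
  have a3 := mul_le_mul_of_nonneg_left h3 hM
  have a4 := mul_nonneg hM hp
  have a5 := mul_nonneg hM hq
  have a6 := mul_nonneg hM a4
  have a7 := mul_nonneg hM a5
  rw [dist_comm] at h1
  refine ⟨?_, ?_, ?_⟩ <;> linarith

theorem whitneyClose_of_dist_le {D : Set ℂ} (hD : IsOpen D) (hDc : Dᶜ.Nonempty) {φ : ℂ → ℂ}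
    (hφ : DifferentiableOn ℂ φ (ball 0 1)) (hinj : InjOn φ (ball 0 1)) (him : φ '' ball 0 1 = D)
    {w w' : ℂ} (hw : w ∈ ball (0 : ℂ) 1) (h : dist w' w ≤ (1 - ‖w‖) / 2) :
    WhitneyClose D (Real.exp 896 + 1) (φ w) (φ w') := by
  have hw1 : 0 < 1 - ‖w‖ := by rw [mem_ball_zero_iff] at hw; linarith
  have hsub : ball w (1 - ‖w‖) ⊆ ball 0 1 := ball_subset_ball' (by simp)
  have key : ∀ q ∈ Dᶜ, dist (φ w') q ≤ Real.exp 896 * dist (φ w) q ∧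
      dist (φ w) q ≤ Real.exp 896 * dist (φ w') q := fun q hq =>
    koebe_distortion (hφ.mono hsub) (hinj.mono hsub)
      (fun u hu heq => hq (by rw [← heq, ← him]; exact mem_image_of_mem φ (hsub hu))) h hw1
  obtain ⟨q, hq, hqd⟩ := hD.isClosed_compl.exists_infDist_eq_dist hDc (φ w)
  obtain ⟨q', hq', hqd'⟩ := hD.isClosed_compl.exists_infDist_eq_dist hDc (φ w')
  have h1 := (key q hq).1
  have h2 := (key q' hq').2
  have h3 := infDist_le_dist_of_mem (x := φ w') hq
  have h4 := infDist_le_dist_of_mem (x := φ w) hq'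
  have h5 := dist_triangle_right (φ w) (φ w') q
  have hp : 0 ≤ infDist (φ w) Dᶜ := infDist_nonneg
  have hp' : 0 ≤ infDist (φ w') Dᶜ := infDist_nonneg
  rw [← hqd] at h1 h5
  rw [← hqd'] at h2
  refine ⟨?_, ?_, ?_⟩ <;> linarith

theorem dist_le_of_dist_map_le {D : Set ℂ} {φ : ℂ → ℂ}
    (hφ : DifferentiableOn ℂ φ (ball 0 1)) (hinj : InjOn φ (ball 0 1)) (him : φ '' ball 0 1 = D)
    {w w' ζ : ℂ} (hw : w ∈ ball (0 : ℂ) 1) (hw' : w' ∈ ball (0 : ℂ) 1) (hζ : ‖ζ‖ = 1)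
    (hpos : 0 < infDist (φ w) Dᶜ) (h : dist (φ w') (φ w) ≤ infDist (φ w) Dᶜ / 2) :
    dist w' ζ ≤ Real.exp 896 * dist w ζ := by
  set ψ := Function.invFunOn φ (ball (0 : ℂ) 1) with hψ
  have hinv : ∀ u ∈ ball (0 : ℂ) 1, ψ (φ u) = u := fun u hu => hinj.leftInvOn_invFunOn hu
  have hd : DifferentiableOn ℂ ψ D :=
    him ▸ differentiableOn_leftInv_of_injOn isOpen_ball hφ hinj hinv
  have hsub : ball (φ w) (infDist (φ w) Dᶜ) ⊆ D := ball_infDist_compl_subset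
  have hmem : ∀ p ∈ D, ψ p ∈ ball (0 : ℂ) 1 ∧ φ (ψ p) = p := by
    intro p hp
    rw [← him] at hp
    obtain ⟨u, hu, rfl⟩ := hp
    rw [hinv u hu]
    exact ⟨hu, rfl⟩
  have hψinj : InjOn ψ D := fun p hp q hq hpq => by
    rw [← (hmem p hp).2, hpq, (hmem q hq).2]
  have := (koebe_distortion (q := ζ) (hd.mono hsub) (hψinj.mono hsub) (fun u hu heq => by
    have := (hmem u (hsub hu)).1
    rw [heq, mem_ball_zero_iff, hζ] at this
    exact lt_irrefl _ this) h hpos).1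
  rwa [hinv w hw, hinv w' hw'] at this

/-- The point at distance `2 ^ (-k)` from the unit circle on the ray through `ζ`. -/
noncomputable def radialPoint (k : ℕ) (ζ : ℂ) : ℂ := (1 - (1 / 2 : ℝ) ^ k) • ζ

theorem half_pow_le_one (k : ℕ) : (1 / 2 : ℝ) ^ k ≤ 1 :=
  pow_le_one₀ (by norm_num) (by norm_num)

theorem norm_radialPoint (k : ℕ) {ζ : ℂ} (hζ : ‖ζ‖ = 1) :
    ‖radialPoint k ζ‖ = 1 - (1 / 2 : ℝ) ^ k := by
  rw [radialPoint, norm_smul, hζ, mul_one, Real.norm_of_nonneg]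
  linarith [half_pow_le_one k]

theorem radialPoint_mem (k : ℕ) {ζ : ℂ} (hζ : ‖ζ‖ = 1) : radialPoint k ζ ∈ ball (0 : ℂ) 1 := by
  rw [mem_ball_zero_iff, norm_radialPoint k hζ]
  have : 0 < (1 / 2 : ℝ) ^ k := by positivity
  linarith

theorem dist_smul_radialPoint (r : ℝ) (k : ℕ) {ζ : ℂ} (hζ : ‖ζ‖ = 1) :
    dist (r • ζ) (radialPoint k ζ) = |r - (1 - (1 / 2 : ℝ) ^ k)| := by
  rw [radialPoint, dist_eq_norm, ← sub_smul, norm_smul, hζ, mul_one, Real.norm_eq_abs]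

theorem dist_radialPoint_self (k : ℕ) {ζ : ℂ} (hζ : ‖ζ‖ = 1) :
    dist (radialPoint k ζ) ζ = (1 / 2 : ℝ) ^ k := by
  have := dist_smul_radialPoint 1 k hζ
  rw [one_smul] at this
  rw [dist_comm, this, sub_sub_cancel, abs_of_nonneg (by positivity)]

theorem dist_radialPoint_le (k : ℕ) (ζ ζ' : ℂ) :
    dist (radialPoint k ζ) (radialPoint k ζ') ≤ dist ζ ζ' := by
  rw [radialPoint, radialPoint, dist_eq_norm, ← smul_sub, norm_smul, dist_eq_norm]
  refine mul_le_of_le_one_left (norm_nonneg _) ?_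
  have : 0 < (1 / 2 : ℝ) ^ k := by positivity
  rw [Real.norm_of_nonneg (by linarith [half_pow_le_one k])]
  linarith

section Radial

variable {D : Set ℂ} {φ : ℂ → ℂ} {K : ℝ}

theorem whitneyClose_radialPoint_succ
    (hstep : ∀ w ∈ ball (0 : ℂ) 1, ∀ w', dist w' w ≤ (1 - ‖w‖) / 2 →
      WhitneyClose D K (φ w) (φ w')) (k : ℕ) {ζ : ℂ} (hζ : ‖ζ‖ = 1) :
    WhitneyClose D K (φ (radialPoint k ζ)) (φ (radialPoint (k + 1) ζ)) := by
  refine hstep _ (radialPoint_mem k hζ) _ ?_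
  rw [radialPoint, dist_smul_radialPoint _ k hζ, norm_radialPoint k hζ, pow_succ]
  have : 0 < (1 / 2 : ℝ) ^ k := by positivity
  rw [abs_of_nonneg (by linarith)]
  linarith

theorem exists_whitneyClose_radialPoint_sub (hK : 1 ≤ K)
    (hstep : ∀ w ∈ ball (0 : ℂ) 1, ∀ w', dist w' w ≤ (1 - ‖w‖) / 2 →
      WhitneyClose D K (φ w) (φ w')) (c : ℕ) :
    ∃ M, 0 ≤ M ∧ ∀ ζ : ℂ, ‖ζ‖ = 1 → ∀ k,
      WhitneyClose D M (φ (radialPoint k ζ)) (φ (radialPoint (k - c) ζ)) := by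
  induction c with
  | zero => exact ⟨1, zero_le_one, fun ζ _ k => WhitneyClose.refl le_rfl _⟩
  | succ c ih =>
    obtain ⟨M, hM, h⟩ := ih
    have hK' : 1 ≤ K + K * K := by nlinarith
    refine ⟨M + M * (K + K * K), by positivity, fun ζ hζ k => ?_⟩
    refine (h ζ hζ k).trans hM (by positivity) ?_
    rw [← Nat.sub_sub]
    rcases Nat.eq_zero_or_pos (k - c) with h0 | h0
    · rw [h0]
      exact WhitneyClose.refl hK' _
    · obtain ⟨m, hm⟩ := Nat.exists_eq_add_of_le' h0
      rw [hm, Nat.add_sub_cancel]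
      exact (whitneyClose_radialPoint_succ hstep m hζ).symm (by positivity)

theorem exists_whitneyClose_radialPoint_of_dist_le (hK : 1 ≤ K)
    (hstep : ∀ w ∈ ball (0 : ℂ) 1, ∀ w', dist w' w ≤ (1 - ‖w‖) / 2 →
      WhitneyClose D K (φ w) (φ w')) (A : ℝ) :
    ∃ M, 0 ≤ M ∧ ∀ ζ ζ' : ℂ, ‖ζ‖ = 1 → ‖ζ'‖ = 1 → ∀ k, dist ζ' ζ ≤ A * (1 / 2 : ℝ) ^ k →
      WhitneyClose D M (φ (radialPoint k ζ)) (φ (radialPoint k ζ')) := by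
  obtain ⟨c, hc⟩ := pow_unbounded_of_one_lt (2 * A) (one_lt_two)
  obtain ⟨M, hM, h⟩ := exists_whitneyClose_radialPoint_sub hK hstep c
  refine ⟨(M + M * K) + (M + M * K) * (M + M * M), by positivity, fun ζ ζ' hζ hζ' k hd => ?_⟩
  refine ((h ζ hζ k).trans hM (by positivity) ?_).trans (by positivity) (by positivity)
    ((h ζ' hζ' k).symm hM)
  rcases le_total k c with hkc | hkc
  · rw [Nat.sub_eq_zero_of_le hkc]
    have : radialPoint 0 ζ = radialPoint 0 ζ' := by simp [radialPoint]
    rw [this]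
    exact WhitneyClose.refl hK _
  · refine hstep _ (radialPoint_mem _ hζ) _ ?_
    rw [norm_radialPoint _ hζ, sub_sub_cancel]
    refine (dist_radialPoint_le _ _ _).trans (hd.trans ?_)
    have h1 : (1 / 2 : ℝ) ^ k * 2 ^ c = (1 / 2 : ℝ) ^ (k - c) := by
      obtain ⟨m, rfl⟩ := Nat.exists_eq_add_of_le' hkc
      rw [Nat.add_sub_cancel, pow_add, mul_assoc, ← mul_pow]
      norm_num
    rw [← h1]
    have : 0 < (1 / 2 : ℝ) ^ k := by positivity
    nlinarith

/-- A point of a geodesic far from the boundary is comparable to some dyadic point `k₀` of the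
geodesic; the last dyadic point `k` far from the boundary is close to the endpoint. -/
theorem exists_radialPoint_far (hK : 1 ≤ K)
    (hstep : ∀ w ∈ ball (0 : ℂ) 1, ∀ w', dist w' w ≤ (1 - ‖w‖) / 2 →
      WhitneyClose D K (φ w) (φ w')) {ζ : ℂ} (hζ : ‖ζ‖ = 1) (hζD : φ ζ ∈ Dᶜ)
    {η : ℝ} {N : ℕ} (hN : ∀ k, N ≤ k → dist (φ (radialPoint k ζ)) (φ ζ) < η)
    {r : ℝ} (hr0 : 0 ≤ r) (hr1 : r < 1) (hr : K * η ≤ infDist (φ (r • ζ)) Dᶜ) :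
    ∃ k₀ k, k₀ ≤ N ∧ k₀ ≤ k ∧ WhitneyClose D K (φ (radialPoint k₀ ζ)) (φ (r • ζ)) ∧
      η ≤ infDist (φ (radialPoint k ζ)) Dᶜ ∧
      dist (φ (radialPoint k ζ)) (φ ζ) ≤ N * (K * (K * η)) + η := by
  have hη : 0 < η := dist_nonneg.trans_lt (hN N le_rfl)
  obtain ⟨k₀, hk1, hk2⟩ := exists_nat_pow_near_of_lt_one (x := 1 - r) (y := 1 / 2)
    (by linarith) (by linarith) (by norm_num) (by norm_num)
  have hclose : WhitneyClose D K (φ (radialPoint k₀ ζ)) (φ (r • ζ)) := by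
    refine hstep _ (radialPoint_mem k₀ hζ) _ ?_
    rw [dist_smul_radialPoint _ _ hζ, norm_radialPoint _ hζ, abs_of_nonneg (by linarith)]
    rw [pow_succ] at hk1
    linarith
  have hfar : η ≤ infDist (φ (radialPoint k₀ ζ)) Dᶜ :=
    le_of_mul_le_mul_left (hr.trans hclose.2.1) (by positivity)
  have hsmall : ∀ k, N ≤ k → infDist (φ (radialPoint k ζ)) Dᶜ < η := fun k hk =>
    (infDist_le_dist_of_mem hζD).trans_lt (hN k hk)
  have hk₀N : k₀ ≤ N := by
    by_contra! hlt
    exact absurd hfar (not_le.2 (hsmall k₀ hlt.le))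
  classical
  set P : ℕ → Prop := fun k => η ≤ infDist (φ (radialPoint k ζ)) Dᶜ with hP
  set k := Nat.findGreatest P N with hk
  have hkP : P k := Nat.findGreatest_spec (P := P) hk₀N hfar
  have hkN : k ≤ N := Nat.findGreatest_le N
  have hgt : ∀ i, k < i → infDist (φ (radialPoint i ζ)) Dᶜ < η := by
    intro i hi
    rcases le_total i N with h | h
    · exact not_le.1 (Nat.findGreatest_is_greatest (P := P) hi h)
    · exact hsmall i h
  have hchain : ∀ n : ℕ, dist (φ (radialPoint k ζ)) (φ (radialPoint (k + n) ζ)) ≤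
      n * (K * (K * η)) := by
    intro n
    induction n with
    | zero => simp
    | succ n ih =>
      have h1 := whitneyClose_radialPoint_succ hstep (k + n) hζ
      have h2 := dist_triangle (φ (radialPoint k ζ)) (φ (radialPoint (k + n) ζ))
        (φ (radialPoint (k + n + 1) ζ))
      have h3 : infDist (φ (radialPoint (k + n) ζ)) Dᶜ ≤ K * η := by
        refine h1.2.2.trans ?_
        gcongr
        exact (hgt _ (by omega)).le
      have h4 := mul_le_mul_of_nonneg_left h3 (by positivity : 0 ≤ K)
      have h5 := h1.1
      rw [← add_assoc]
      push_cast
      linarith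
  refine ⟨k₀, k, hk₀N, Nat.le_findGreatest hk₀N hfar, hclose, hkP, ?_⟩
  have h1 := hchain (N - k)
  rw [Nat.add_sub_cancel' hkN] at h1
  have h2 := dist_triangle (φ (radialPoint k ζ)) (φ (radialPoint N ζ)) (φ ζ)
  have h3 := hN N le_rfl
  have h4 : ((N - k : ℕ) : ℝ) * (K * (K * η)) ≤ N * (K * (K * η)) := by
    gcongr
    exact Nat.sub_le N k
  linarith

end Radial

/-- A function that is Hölder near the boundary set `φ ⁻¹ X` satisfies a Hölder estimate along all
radii ending there. -/
theorem exists_dist_radialPoint_le {φ : ℂ → ℂ} (hφ : ContinuousOn φ (closedBall 0 1)) {X : Set ℂ}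
    {β δ : ℝ} (hβ : 0 < β) (hδ : 0 < δ)
    (hH : ∃ C : ℝ≥0, HolderOnWith C β.toNNReal φ
      {w ∈ ball (0 : ℂ) 1 | infDist w (sphere (0 : ℂ) 1 ∩ φ ⁻¹' X) < δ}) :
    ∃ C, 0 ≤ C ∧ ∀ ζ : ℂ, ‖ζ‖ = 1 → φ ζ ∈ X → ∀ k,
      dist (φ (radialPoint k ζ)) (φ ζ) ≤ C * ((1 / 2 : ℝ) ^ k) ^ β := by
  obtain ⟨C, hC⟩ := hH
  obtain ⟨B, hB⟩ := ((isCompact_closedBall (0 : ℂ) 1).image_of_continuousOn hφ).isBounded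
    |> Metric.isBounded_iff.1
  have hsph : ∀ ζ : ℂ, ‖ζ‖ = 1 → ζ ∈ closedBall (0 : ℂ) 1 := fun ζ hζ => by simp [hζ]
  refine ⟨C + |B| * (δ ^ β)⁻¹, by positivity, fun ζ hζ hζX k => ?_⟩
  have hx : 0 < (1 / 2 : ℝ) ^ k := by positivity
  have hxβ : 0 < ((1 / 2 : ℝ) ^ k) ^ β := by positivity
  have hδβ : 0 < δ ^ β := by positivity
  rw [add_mul]
  rcases lt_or_ge ((1 / 2 : ℝ) ^ k) δ with hlt | hge
  · have hmem : ∀ n, k ≤ n → radialPoint n ζ ∈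
        {w ∈ ball (0 : ℂ) 1 | infDist w (sphere (0 : ℂ) 1 ∩ φ ⁻¹' X) < δ} := by
      intro n hn
      refine ⟨radialPoint_mem n hζ, ?_⟩
      have h1 : ζ ∈ sphere (0 : ℂ) 1 ∩ φ ⁻¹' X := ⟨by simp [hζ], hζX⟩
      refine (infDist_le_dist_of_mem h1).trans_lt ?_
      rw [dist_radialPoint_self n hζ]
      exact (pow_le_pow_of_le_one (by norm_num) (by norm_num) hn).trans_lt hlt
    have hn : ∀ n, k ≤ n → dist (φ (radialPoint k ζ)) (φ (radialPoint n ζ)) ≤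
        C * ((1 / 2 : ℝ) ^ k) ^ β := by
      intro n hn
      have h2 : dist (radialPoint k ζ) (radialPoint n ζ) ≤ (1 / 2 : ℝ) ^ k := by
        have h3 : (1 / 2 : ℝ) ^ n ≤ (1 / 2 : ℝ) ^ k :=
          pow_le_pow_of_le_one (by norm_num) (by norm_num) hn
        have h4 : 0 < (1 / 2 : ℝ) ^ n := by positivity
        rw [radialPoint, dist_smul_radialPoint _ _ hζ, abs_le]
        constructor <;> linarith
      have := hC.dist_le_of_le (hmem k le_rfl) (hmem n hn) h2
      rwa [Real.coe_toNNReal β hβ.le] at this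
    have hlim : Tendsto (fun n => φ (radialPoint n ζ)) atTop (𝓝 (φ ζ)) := by
      have h1 : Tendsto (fun n => radialPoint n ζ) atTop (𝓝 ζ) := by
        rw [tendsto_iff_dist_tendsto_zero]
        simp_rw [dist_radialPoint_self _ hζ]
        exact tendsto_pow_atTop_nhds_zero_of_lt_one (by norm_num) (by norm_num)
      exact (hφ ζ (hsph ζ hζ)).tendsto.comp (tendsto_nhdsWithin_iff.2
        ⟨h1, Eventually.of_forall fun n => ball_subset_closedBall (radialPoint_mem n hζ)⟩)
    have h1 : dist (φ (radialPoint k ζ)) (φ ζ) ≤ C * ((1 / 2 : ℝ) ^ k) ^ β :=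
      le_of_tendsto (tendsto_const_nhds.dist hlim) ((eventually_ge_atTop k).mono hn)
    have : 0 ≤ |B| * (δ ^ β)⁻¹ * ((1 / 2 : ℝ) ^ k) ^ β := by positivity
    linarith
  · have h1 : dist (φ (radialPoint k ζ)) (φ ζ) ≤ |B| :=
      (hB (mem_image_of_mem φ (ball_subset_closedBall (radialPoint_mem k hζ)))
        (mem_image_of_mem φ (hsph ζ hζ))).trans (le_abs_self B)
    have h2 : 1 ≤ (δ ^ β)⁻¹ * ((1 / 2 : ℝ) ^ k) ^ β := by
      rw [inv_mul_eq_div, one_le_div hδβ]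
      exact Real.rpow_le_rpow hδ.le hge hβ.le
    have h3 : |B| ≤ |B| * ((δ ^ β)⁻¹ * ((1 / 2 : ℝ) ^ k) ^ β) :=
      le_mul_of_one_le_right (abs_nonneg B) h2
    have h4 : 0 ≤ (C : ℝ) * ((1 / 2 : ℝ) ^ k) ^ β := by positivity
    rw [← mul_assoc] at h3
    linarith

theorem exists_mul_rpow_half_pow_lt {C β ε : ℝ} (hC : 0 ≤ C) (hβ : 0 < β) (hε : 0 < ε) :
    ∃ N : ℕ, ∀ j k : ℕ, N * (j + 1) ≤ k → C * ((1 / 2 : ℝ) ^ k) ^ β < ε * (1 / 2 : ℝ) ^ j := by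
  set x : ℝ := (1 / 2 : ℝ) ^ β with hx
  have hx0 : 0 < x := by positivity
  have hx1 : x < 1 := Real.rpow_lt_one (by norm_num) (by norm_num) hβ
  have hpow : ∀ k : ℕ, ((1 / 2 : ℝ) ^ k) ^ β = x ^ k := by
    intro k
    rw [hx, ← Real.rpow_natCast, ← Real.rpow_natCast, ← Real.rpow_mul (by norm_num),
      ← Real.rpow_mul (by norm_num), mul_comm]
  obtain ⟨N, hN⟩ := exists_pow_lt_of_lt_one
    (show 0 < min (1 / 2) (ε / (C + 1)) by positivity) hx1
  refine ⟨N, fun j k hk => ?_⟩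
  rw [hpow]
  have h1 : x ^ N ≤ 1 / 2 := hN.le.trans (min_le_left _ _)
  have h2 : x ^ N * (C + 1) < ε := by
    rw [← lt_div_iff₀ (by positivity)]
    exact hN.trans_le (min_le_right _ _)
  have h3 : C * x ^ N < ε := by
    have : 0 < x ^ N := by positivity
    linarith
  calc C * x ^ k ≤ C * x ^ (N * (j + 1)) := by
        gcongr C * ?_
        exact pow_le_pow_of_le_one hx0.le hx1.le hk
    _ = C * x ^ N * (x ^ N) ^ j := by rw [pow_mul, pow_succ]; ring
    _ ≤ C * x ^ N * (1 / 2) ^ j := by gcongr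
    _ < ε * (1 / 2) ^ j := by gcongr

/-- The index of the cell containing `p` in the grid of mesh `s`. -/
noncomputable def gridCell (s : ℝ) (p : ℂ) : ℤ × ℤ := (⌊p.re / s⌋, ⌊p.im / s⌋)

theorem abs_sub_lt_of_gridCell_eq {s : ℝ} (hs : 0 < s) {p q : ℂ}
    (h : gridCell s p = gridCell s q) : |p.re - q.re| < s ∧ |p.im - q.im| < s := by
  have aux : ∀ x y : ℝ, ⌊x / s⌋ = ⌊y / s⌋ → |x - y| < s := by
    intro x y hxy
    have := Int.abs_sub_lt_one_of_floor_eq_floor hxy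
    rwa [← sub_div, abs_div, abs_of_pos hs, div_lt_one hs] at this
  exact ⟨aux _ _ (congrArg Prod.fst h), aux _ _ (congrArg Prod.snd h)⟩

theorem dist_lt_of_gridCell_eq {s : ℝ} (hs : 0 < s) {p q : ℂ}
    (h : gridCell s p = gridCell s q) : dist p q < 2 * s := by
  obtain ⟨h1, h2⟩ := abs_sub_lt_of_gridCell_eq hs h
  have := Complex.norm_le_abs_re_add_abs_im (p - q)
  rw [sub_re, sub_im] at this
  rw [dist_eq_norm]
  linarith

theorem gridCell_mem_Icc {s : ℝ} (hs : 0 < s) {p q : ℂ} {L : ℕ} (h : dist p q ≤ L * s) :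
    gridCell s p ∈ Finset.Icc (gridCell s q - ((L : ℤ) + 1, (L : ℤ) + 1))
      (gridCell s q + ((L : ℤ) + 1, (L : ℤ) + 1)) := by
  have aux : ∀ x y : ℝ, |x - y| ≤ L * s →
      ⌊y / s⌋ - ((L : ℤ) + 1) ≤ ⌊x / s⌋ ∧ ⌊x / s⌋ ≤ ⌊y / s⌋ + ((L : ℤ) + 1) := by
    intro x y hxy
    have h1 : |x / s - y / s| ≤ L := by
      rw [← sub_div, abs_div, abs_of_pos hs]
      exact (div_le_iff₀ hs).2 hxy
    obtain ⟨h2, h3⟩ := abs_le.1 h1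
    have e1 := Int.floor_le (x / s)
    have e2 := Int.lt_floor_add_one (x / s)
    have e3 := Int.floor_le (y / s)
    have e4 := Int.lt_floor_add_one (y / s)
    constructor
    · have : (⌊y / s⌋ : ℝ) < ((⌊x / s⌋ + ((L : ℤ) + 1) : ℤ) : ℝ) := by push_cast; linarith
      have := Int.cast_lt.1 this
      omega
    · have : (⌊x / s⌋ : ℝ) < ((⌊y / s⌋ + ((L : ℤ) + 1) : ℤ) : ℝ) := by push_cast; linarith
      have := Int.cast_lt.1 this
      omega
  rw [dist_eq_norm] at h
  have hre := aux p.re q.re (by rw [← sub_re]; exact (abs_re_le_norm _).trans h)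
  have him := aux p.im q.im (by rw [← sub_im]; exact (abs_im_le_norm _).trans h)
  rw [Finset.mem_Icc]
  exact ⟨⟨hre.1, him.1⟩, ⟨hre.2, him.2⟩⟩

theorem card_Icc_sub_add (x : ℤ × ℤ) (L : ℕ) :
    (Finset.Icc (x - ((L : ℤ) + 1, (L : ℤ) + 1)) (x + ((L : ℤ) + 1, (L : ℤ) + 1))).card =
      (2 * L + 3) ^ 2 := by
  rw [Finset.card_Icc_prod]
  simp only [Prod.fst_sub, Prod.snd_sub, Prod.fst_add, Prod.snd_add, Int.card_Icc]
  rw [show x.1 + ((L : ℤ) + 1) + 1 - (x.1 - ((L : ℤ) + 1)) = ((2 * L + 3 : ℕ) : ℤ) by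
    push_cast; ring, show x.2 + ((L : ℤ) + 1) + 1 - (x.2 - ((L : ℤ) + 1)) = ((2 * L + 3 : ℕ) : ℤ) by
    push_cast; ring, Int.toNat_natCast]
  ring

theorem mem_interior_squareSet {c w : ℂ} {l : ℝ} (h1 : |w.re - c.re| < l / 2)
    (h2 : |w.im - c.im| < l / 2) : w ∈ interior (squareSet c l) := by
  have hre : IsOpen {w : ℂ | |w.re - c.re| < l / 2} := isOpen_lt (by fun_prop) continuous_const
  have him : IsOpen {w : ℂ | |w.im - c.im| < l / 2} := isOpen_lt (by fun_prop) continuous_const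
  have hopen : IsOpen {w : ℂ | |w.re - c.re| < l / 2 ∧ |w.im - c.im| < l / 2} := hre.and him
  have hsub : {w : ℂ | |w.re - c.re| < l / 2 ∧ |w.im - c.im| < l / 2} ⊆ squareSet c l :=
    fun w hw => ⟨hw.1.le, hw.2.le⟩
  exact interior_maximal hsub hopen (And.intro h1 h2)

theorem IsWhitneyDecomposition.eq_of_gridCell_eq {D : Set ℂ} {𝒲 : Set (ℂ × ℝ)}
    (h𝒲 : IsWhitneyDecomposition D 𝒲) {q q' : ℂ × ℝ} (hq : q ∈ 𝒲) (hq' : q' ∈ 𝒲)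
    (hl : q.2 = q'.2) (h : gridCell q.2 q.1 = gridCell q.2 q'.1) : q = q' := by
  by_contra hne
  obtain ⟨h1, h2⟩ := abs_sub_lt_of_gridCell_eq (h𝒲.len_pos q hq) h
  have h3 := abs_lt.1 h1
  have h4 := abs_lt.1 h2
  set m : ℂ := ⟨(q.1.re + q'.1.re) / 2, (q.1.im + q'.1.im) / 2⟩ with hm
  have hmq : m ∈ interior (squareSet q.1 q.2) := by
    apply mem_interior_squareSet <;> rw [hm, abs_lt] <;> constructor <;> dsimp only <;> linarith
  have hmq' : m ∈ interior (squareSet q'.1 q'.2) := by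
    apply mem_interior_squareSet <;> rw [hm, abs_lt] <;> constructor <;> dsimp only <;> linarith
  exact Set.disjoint_left.1 (h𝒲.disj q hq q' hq' hne) hmq hmq'

theorem dist_le_of_mem_squareSet {c w : ℂ} {l : ℝ} (h : w ∈ squareSet c l) :
    dist w c ≤ 3 / 4 * l := by
  obtain ⟨h1, h2⟩ := h
  have hl : 0 ≤ l := by linarith [abs_nonneg (w.re - c.re)]
  rw [dist_eq_norm]
  refine (sq_le_sq₀ (norm_nonneg _) (by positivity)).1 ?_
  rw [Complex.sq_norm, Complex.normSq_apply, sub_re, sub_im]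
  have e1 := abs_le.1 h1
  have e2 := abs_le.1 h2
  nlinarith

theorem ncard_le_of_gridCell {α κ : Type*} {S : Set α} {key : α → κ} {code : α → ℤ × ℤ}
    {T : Finset κ} {L : ℕ} (hcode : InjOn code S) (hT : ∀ Q ∈ S, key Q ∈ T)
    (hfib : ∀ Q ∈ S, ∀ Q' ∈ S, key Q = key Q' →
      code Q' ∈ Finset.Icc (code Q - ((L : ℤ) + 1, (L : ℤ) + 1))
        (code Q + ((L : ℤ) + 1, (L : ℤ) + 1))) :
    S.ncard ≤ (2 * L + 3) ^ 2 * T.card := by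
  classical
  by_cases hS : S.Finite
  swap
  · rw [Set.Infinite.ncard hS]; exact Nat.zero_le _
  rw [Set.ncard_eq_toFinset_card S hS]
  refine (Finset.card_le_mul_card_image (f := key) hS.toFinset ((2 * L + 3) ^ 2) ?_).trans
    (Nat.mul_le_mul_left _ (Finset.card_le_card ?_))
  · intro b hb
    obtain ⟨Q, hQ, rfl⟩ := Finset.mem_image.1 hb
    rw [hS.mem_toFinset] at hQ
    rw [← card_Icc_sub_add (code Q) L]
    refine Finset.card_le_card_of_injOn code ?_ ?_
    · intro Q' hQ'
      simp only [Finset.coe_filter, hS.mem_toFinset, mem_ofPred_eq] at hQ'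
      exact hfib Q hQ Q' hQ'.1 hQ'.2.symm
    · intro Q' hQ' Q'' hQ'' h
      simp only [Finset.coe_filter, hS.mem_toFinset, mem_ofPred_eq] at hQ' hQ''
      exact hcode hQ'.1 hQ''.1 h
  · intro b hb
    obtain ⟨Q, hQ, rfl⟩ := Finset.mem_image.1 hb
    exact hT Q (hS.mem_toFinset.1 hQ)

theorem exists_finset_of_coverNum_le {X : Set ℂ} {ε v : ℝ} (hv : 1 ≤ v)
    (h : coverNum X ε ≤ ENNReal.ofReal v) :
    ∃ T : Finset ℂ, (T.card : ℝ) ≤ 2 * v ∧ X ⊆ ⋃ x ∈ T, ball x ε := by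
  have hlt : coverNum X ε < ENNReal.ofReal (2 * v) :=
    h.trans_lt ((ENNReal.ofReal_lt_ofReal_iff (by linarith)).2 (by linarith))
  obtain ⟨n, ⟨T, hTn, hT⟩, hn⟩ := sInf_lt_iff.1 hlt
  refine ⟨T, ?_, hT⟩
  rw [← hTn, ← ENNReal.ofReal_natCast, ENNReal.ofReal_lt_ofReal_iff (by linarith)] at hn
  exact hn.le

theorem exists_add_one_pow_three_le {a : ℝ} (ha : 0 < a) :
    ∃ C, 0 < C ∧ ∀ j : ℕ, ((j : ℝ) + 1) ^ 3 ≤ C * 2 ^ (a * j) := by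
  set r : ℝ := 2 ^ (-a) with hr
  have hr0 : 0 < r := by positivity
  have hr1 : r < 1 := Real.rpow_lt_one_of_one_lt_of_neg one_lt_two (by linarith)
  obtain ⟨C, hC⟩ := (tendsto_pow_const_mul_const_pow_of_abs_lt_one 3
    (by rwa [abs_of_pos hr0])).bddAbove_range
  have hC' : ∀ n : ℕ, (n : ℝ) ^ 3 * r ^ n ≤ C := fun n => hC ⟨n, rfl⟩
  have hCp : 0 < C := lt_of_lt_of_le (by simpa using hr0) (hC' 1)
  refine ⟨C / r, by positivity, fun j => ?_⟩
  have h1 := hC' (j + 1)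
  have h2 : (2 : ℝ) ^ (a * j) = (r ^ j)⁻¹ := by
    rw [hr, ← Real.rpow_natCast, ← Real.rpow_mul (by norm_num), ← Real.rpow_neg (by norm_num)]
    congr 1
    ring
  rw [h2, ← div_eq_mul_inv, div_div, le_div_iff₀ (by positivity)]
  rw [pow_succ r] at h1
  push_cast at h1
  linarith [mul_comm (r ^ j) r]

/-- The squares of side length `2 ^ (-j)` hit by a geodesic ending in `X`. -/
def hitSquares (φ : ℂ → ℂ) (X : Set ℂ) (𝒲 : Set (ℂ × ℝ)) (j : ℕ) : Set (ℂ × ℝ) :=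
  {Q : ℂ × ℝ | Q ∈ 𝒲 ∧ Q.2 = (2 : ℝ)⁻¹ ^ j ∧
    ∃ w ∈ X, ∃ ζ ∈ sphere (0 : ℂ) 1, φ ζ = w ∧
      ∃ t : ℝ, 0 ≤ t ∧ φ (Real.tanh t • ζ) ∈ squareSet Q.1 Q.2}

theorem exists_ncard_hitSquares_le {D : Set ℂ} (hD : IsOpen D) (hDc : Dᶜ.Nonempty)
    {φ : ℂ → ℂ} (hcont : ContinuousOn φ (closedBall (0 : ℂ) 1))
    (hφ : DifferentiableOn ℂ φ (ball (0 : ℂ) 1)) (hinj : InjOn φ (ball (0 : ℂ) 1))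
    (him : φ '' ball (0 : ℂ) 1 = D) {X : Set ℂ} (hX : X ⊆ Dᶜ) {β δ : ℝ} (hβ : 0 < β) (hδ : 0 < δ)
    (hH : ∃ C : ℝ≥0, HolderOnWith C β.toNNReal φ
      {w ∈ ball (0 : ℂ) 1 | infDist w (sphere (0 : ℂ) 1 ∩ φ ⁻¹' X) < δ})
    {𝒲 : Set (ℂ × ℝ)} (h𝒲 : IsWhitneyDecomposition D 𝒲) :
    ∃ A : ℝ, 0 ≤ A ∧ ∀ (j : ℕ) (T : Finset ℂ), X ⊆ ⋃ x ∈ T, ball x ((1 / 2 : ℝ) ^ j) →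
      ((hitSquares φ X 𝒲 j).ncard : ℝ) ≤ A * T.card * ((j : ℝ) + 1) ^ 3 := by
  obtain ⟨K, hK, hstep⟩ : ∃ K : ℝ, 1 ≤ K ∧ ∀ w ∈ ball (0 : ℂ) 1, ∀ w',
      dist w' w ≤ (1 - ‖w‖) / 2 → WhitneyClose D K (φ w) (φ w') :=
    ⟨Real.exp 896 + 1, by linarith [Real.exp_pos 896],
      fun w hw w' h => whitneyClose_of_dist_le hD hDc hφ hinj him hw h⟩
  obtain ⟨E, hE, hinv⟩ : ∃ E : ℝ, 0 ≤ E ∧ ∀ w ∈ ball (0 : ℂ) 1, ∀ w' ∈ ball (0 : ℂ) 1,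
      ∀ ζ : ℂ, ‖ζ‖ = 1 → 0 < infDist (φ w) Dᶜ → dist (φ w') (φ w) ≤ infDist (φ w) Dᶜ / 2 →
        dist w' ζ ≤ E * dist w ζ :=
    ⟨Real.exp 896, (Real.exp_pos _).le, fun w hw w' hw' ζ hζ hpos h =>
      dist_le_of_dist_map_le hφ hinj him hw hw' hζ hpos h⟩
  obtain ⟨C, hC, hHol⟩ := exists_dist_radialPoint_le hcont hβ hδ hH
  have hK0 : 0 < K := by linarith
  obtain ⟨N₀, hN₀⟩ := exists_mul_rpow_half_pow_lt hC hβ (ε := (4 * K)⁻¹) (by positivity)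
  obtain ⟨M, hM, hnear⟩ := exists_whitneyClose_radialPoint_of_dist_le hK hstep (2 * E)
  obtain ⟨L₀, hL₀⟩ := exists_nat_ge (4 * (N₀ * (K * K) + 1 + 4 * K))
  obtain ⟨B, hB⟩ := exists_nat_ge (3 / 2 + 18 * K * K + 9 * M * K)
  refine ⟨((2 * B + 3) ^ 2 * (N₀ + 1) * (2 * L₀ + 3) ^ 2 : ℕ), by positivity, fun j T hT => ?_⟩
  set s : ℝ := (1 / 2 : ℝ) ^ j with hs
  have hs0 : 0 < s := by positivity
  have hsj : (2 : ℝ)⁻¹ ^ j = s := by rw [hs]; norm_num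
  set η : ℝ := (4 * K)⁻¹ * s with hη
  have hη0 : 0 < η := by positivity
  have hKη : K * η = s / 4 := by rw [hη]; field_simp
  set N := N₀ * (j + 1) with hN
  set L := L₀ * (j + 1) with hL
  have hdata : ∀ Q ∈ hitSquares φ X 𝒲 j, ∃ (x ζ : ℂ) (k₀ k : ℕ) (y : ℂ), x ∈ T ∧ ‖ζ‖ = 1 ∧
      k₀ ≤ N ∧ k₀ ≤ k ∧ dist y Q.1 ≤ 3 / 4 * s ∧ infDist y Dᶜ ≤ 9 * s ∧
      WhitneyClose D K (φ (radialPoint k₀ ζ)) y ∧ η ≤ infDist (φ (radialPoint k ζ)) Dᶜ ∧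
      dist (φ (radialPoint k ζ)) x ≤ L * (η / 4) := by
    rintro Q ⟨hQ, hQs, w, hw, ζ, hζ, rfl, t, ht, hy⟩
    rw [hsj] at hQs
    rw [mem_sphere_zero_iff_norm] at hζ
    have hyQ := dist_le_of_mem_squareSet hy
    obtain ⟨hc1, hc2⟩ := h𝒲.comparable Q hQ
    rw [hQs] at hyQ hc1 hc2
    have hy1 := infDist_le_infDist_add_dist (s := Dᶜ) (x := φ (Real.tanh t • ζ)) (y := Q.1)
    have hy2 := infDist_le_infDist_add_dist (s := Dᶜ) (y := φ (Real.tanh t • ζ)) (x := Q.1)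
    rw [dist_comm] at hy2
    have hsmall : ∀ k, N ≤ k → dist (φ (radialPoint k ζ)) (φ ζ) < η := fun k hk =>
      (hHol ζ hζ hw k).trans_lt (hN₀ j k hk)
    obtain ⟨k₀, k, h1, h2, h3, h4, h5⟩ := exists_radialPoint_far hK hstep hζ (hX hw) hsmall
      (by rw [Real.tanh_eq_sinh_div_cosh]
          exact div_nonneg (Real.sinh_nonneg_iff.2 ht) (Real.cosh_pos t).le)
      (Real.tanh_lt_one t) (by linarith)
    obtain ⟨x, hx, hxw⟩ : ∃ x ∈ T, dist (φ ζ) x < s := by simpa using hT hw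
    refine ⟨x, ζ, k₀, k, φ (Real.tanh t • ζ), hx, hζ, h1, h2, hyQ, by linarith, h3, h4, ?_⟩
    have h6 := dist_triangle (φ (radialPoint k ζ)) (φ ζ) x
    have h7 : s = 4 * K * η := by linarith
    have h8 : (1 : ℝ) ≤ (j : ℝ) + 1 := by linarith [(Nat.cast_nonneg j : (0 : ℝ) ≤ j)]
    calc _ ≤ N * (K * (K * η)) + η + 4 * K * η := by linarith
      _ = ((j + 1) * (N₀ * (K * K)) + 1 * (1 + 4 * K)) * η := by rw [hN]; push_cast; ring
      _ ≤ ((j + 1) * (N₀ * (K * K)) + (j + 1) * (1 + 4 * K)) * η := by gcongr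
      _ = (4 * (N₀ * (K * K) + 1 + 4 * K)) * (j + 1) * (η / 4) := by ring
      _ ≤ L₀ * (j + 1) * (η / 4) := by gcongr
      _ = L * (η / 4) := by rw [hL]; push_cast; ring
  choose! x ζ k₀ k y hx hζ hk₀N hk₀k hyQ hyD hclose hfar hpx using hdata
  have hcount := ncard_le_of_gridCell (S := hitSquares φ X 𝒲 j)
    (key := fun Q => ((x Q, k₀ Q), gridCell (η / 4) (φ (radialPoint (k Q) (ζ Q)) - x Q)))
    (code := fun Q => gridCell s Q.1)
    (T := (T ×ˢ Finset.range (N + 1)) ×ˢ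
      Finset.Icc (gridCell (η / 4) 0 - ((L : ℤ) + 1, (L : ℤ) + 1))
        (gridCell (η / 4) 0 + ((L : ℤ) + 1, (L : ℤ) + 1))) (L := B) ?_ ?_ ?_
  · rw [Finset.card_product, Finset.card_product, Finset.card_range, card_Icc_sub_add] at hcount
    have h1 : N + 1 ≤ (N₀ + 1) * (j + 1) := by rw [hN]; nlinarith
    have h2 : 2 * L + 3 ≤ (2 * L₀ + 3) * (j + 1) := by rw [hL]; nlinarith
    have h3 : (hitSquares φ X 𝒲 j).ncard ≤
        (2 * B + 3) ^ 2 * (T.card * ((N₀ + 1) * (j + 1)) * ((2 * L₀ + 3) * (j + 1)) ^ 2) := by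
      refine hcount.trans ?_
      gcongr
    have h4 : (hitSquares φ X 𝒲 j).ncard ≤
        (2 * B + 3) ^ 2 * (N₀ + 1) * (2 * L₀ + 3) ^ 2 * T.card * (j + 1) ^ 3 :=
      h3.trans_eq (by ring)
    exact_mod_cast h4
  · intro Q hQ Q' hQ' h
    have e : Q.2 = s := hQ.2.1.trans hsj
    have e' : Q'.2 = s := hQ'.2.1.trans hsj
    refine h𝒲.eq_of_gridCell_eq hQ.1 hQ'.1 (e.trans e'.symm) ?_
    rw [e]
    exact h
  · intro Q hQ
    simp only [Finset.mem_product, Finset.mem_range]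
    refine ⟨⟨hx Q hQ, Nat.lt_succ_of_le (hk₀N Q hQ)⟩, gridCell_mem_Icc (by positivity) ?_⟩
    rw [dist_zero_right, ← dist_eq_norm]
    exact hpx Q hQ
  · intro Q hQ Q' hQ' hkey
    simp only [Prod.mk.injEq] at hkey
    obtain ⟨⟨hxx, hkk⟩, hcell⟩ := hkey
    refine gridCell_mem_Icc hs0 ?_
    have hdist : dist (φ (radialPoint (k Q') (ζ Q'))) (φ (radialPoint (k Q) (ζ Q))) ≤
        infDist (φ (radialPoint (k Q) (ζ Q))) Dᶜ / 2 := by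
      have h1 := dist_lt_of_gridCell_eq (by positivity) hcell.symm
      rw [hxx, dist_sub_right] at h1
      linarith [hfar Q hQ]
    have hw' := hinv _ (radialPoint_mem (k Q) (hζ Q hQ)) _ (radialPoint_mem (k Q') (hζ Q' hQ'))
      (ζ Q) (hζ Q hQ) (hη0.trans_le (hfar Q hQ)) hdist
    rw [dist_radialPoint_self _ (hζ Q hQ)] at hw'
    have hζζ : dist (ζ Q') (ζ Q) ≤ 2 * E * (1 / 2 : ℝ) ^ k₀ Q := by
      have h1 := norm_sub_norm_le (ζ Q) (radialPoint (k Q') (ζ Q'))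
      rw [hζ Q hQ, norm_radialPoint _ (hζ Q' hQ'), ← dist_eq_norm, dist_comm] at h1
      have h2 := dist_triangle_left (ζ Q') (ζ Q) (radialPoint (k Q') (ζ Q'))
      rw [dist_radialPoint_self _ (hζ Q' hQ')] at h2
      have h3 : E * (1 / 2 : ℝ) ^ k Q ≤ E * (1 / 2 : ℝ) ^ k₀ Q :=
        mul_le_mul_of_nonneg_left
          (pow_le_pow_of_le_one (by norm_num) (by norm_num) (hk₀k Q hQ)) hE
      linarith
    have hc := hnear (ζ Q) (ζ Q') (hζ Q hQ) (hζ Q' hQ') (k₀ Q) hζζ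
    have hcQ := hclose Q hQ
    have hcQ' := hclose Q' hQ'
    rw [← hkk] at hcQ'
    have hρ : infDist (φ (radialPoint (k₀ Q) (ζ Q))) Dᶜ ≤ 9 * K * s := by
      nlinarith [hcQ.2.2, hyD Q hQ]
    have hρ' : infDist (φ (radialPoint (k₀ Q) (ζ Q'))) Dᶜ ≤ 9 * K * s := by
      nlinarith [hcQ'.2.2, hyD Q' hQ']
    have h1 := mul_le_mul_of_nonneg_left hρ hK0.le
    have h2 := mul_le_mul_of_nonneg_left hρ' hK0.le
    have h3 := mul_le_mul_of_nonneg_left hρ hM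
    have h4 := mul_le_mul_of_nonneg_right hB hs0.le
    have t1 := dist_triangle_left Q'.1 Q.1 (y Q')
    have t2 := dist_triangle (y Q') (φ (radialPoint (k₀ Q) (ζ Q'))) Q.1
    have t3 := dist_triangle_left (φ (radialPoint (k₀ Q) (ζ Q'))) Q.1
      (φ (radialPoint (k₀ Q) (ζ Q)))
    have t4 := dist_triangle (φ (radialPoint (k₀ Q) (ζ Q))) (y Q) Q.1
    have t5 := dist_comm (y Q') (φ (radialPoint (k₀ Q) (ζ Q')))
    linarith [hcQ.1, hcQ'.1, hc.1, hyQ Q hQ, hyQ Q' hQ']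

/-- **Counting Whitney squares of a given size hit by geodesics towards a boundary set.**
`D` is a bounded Jordan domain (encoded via the boundary extension of the Riemann map `φ`
with `φ 0 = z ∈ D`, `φ' 0 > 0`), `X ⊆ ∂D` is closed with upper Minkowski dimension at most
`d ∈ (0,2)` (encoded through covering numbers: for every `d' > d`, eventually as `ε → 0⁺`
one needs at most `ε^{-d'}` balls of radius `ε` to cover `X`), and `φ` is `β`-Hölder on the
`δ`-neighborhood in the disk of `φ⁻¹ X ⊆ ∂𝔻`.  Let `𝒲` be a Whitney square decomposition
of `D` and, for `j : ℕ`, let `𝒲_j` be the set of squares of `𝒲` of side length `2^{-j}`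
hit by some hyperbolic geodesic in `D` from `z` to a point of `X` (the image under `φ` of a
radial geodesic `t ↦ tanh t • ζ` with `ζ ∈ ∂𝔻`, `φ ζ = w ∈ X`).  Then for every
`a ∈ (0,1)` there is `c = c(a, β, δ, X, D, z) > 0` with `|𝒲_j| ≤ c * 2^{(d+a) j}` for all
`j ∈ ℕ`. -/
theorem whitney_square_count
    (D : Set ℂ) (hDopen : IsOpen D) (hDbd : Bornology.IsBounded D)
    (z : ℂ) (hz : z ∈ D)
    (φ : ℂ → ℂ)
    (hφcont : ContinuousOn φ (closedBall (0 : ℂ) 1))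
    (hφdiff : DifferentiableOn ℂ φ (ball (0 : ℂ) 1))
    (hφinj : Set.InjOn φ (closedBall (0 : ℂ) 1))
    (hφim : φ '' ball (0 : ℂ) 1 = D)
    (hφbd : φ '' sphere (0 : ℂ) 1 = frontier D)
    (hφ0 : φ 0 = z)
    (hφ'0 : (deriv φ 0).im = 0 ∧ 0 < (deriv φ 0).re)
    (β : ℝ) (hβ : β ∈ Set.Ioo (0 : ℝ) 1)
    (d : ℝ) (hd : d ∈ Set.Ioo (0 : ℝ) 2)
    (X : Set ℂ) (hXcl : IsClosed X) (hXsub : X ⊆ frontier D)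
    (hdim : ∀ d' : ℝ, d < d' → ∀ᶠ ε in 𝓝[>] (0 : ℝ),
      coverNum X ε ≤ ENNReal.ofReal (ε ^ (-d')))
    (δ : ℝ) (hδ : δ ∈ Set.Ioo (0 : ℝ) 1)
    (hHolder : ∃ C : ℝ≥0, HolderOnWith C β.toNNReal φ
      {w ∈ ball (0 : ℂ) 1 | Metric.infDist w (sphere (0 : ℂ) 1 ∩ φ ⁻¹' X) < δ})
    (𝒲 : Set (ℂ × ℝ)) (h𝒲 : IsWhitneyDecomposition D 𝒲)
    (a : ℝ) (ha : a ∈ Set.Ioo (0 : ℝ) 1) :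
    ∃ cst : ℝ, 0 < cst ∧ ∀ j : ℕ,
      (Set.ncard {Q : ℂ × ℝ | Q ∈ 𝒲 ∧ Q.2 = (2 : ℝ)⁻¹ ^ j ∧
          ∃ w ∈ X, ∃ ζ ∈ sphere (0 : ℂ) 1, φ ζ = w ∧
            ∃ t : ℝ, 0 ≤ t ∧ φ (Real.tanh t • ζ) ∈ squareSet Q.1 Q.2} : ℝ) ≤
        cst * 2 ^ ((d + a) * j) := by
  obtain ⟨ha0, ha1⟩ := ha
  have hDc : Dᶜ.Nonempty := by
    rw [nonempty_compl]
    rintro rfl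
    exact NormedSpace.unbounded_univ ℂ ℂ hDbd
  have hX : X ⊆ Dᶜ := fun p hp hpD => by
    have := hXsub hp
    rw [hDopen.frontier_eq] at this
    exact this.2 hpD
  obtain ⟨A, hA, hcount⟩ := exists_ncard_hitSquares_le hDopen hDc hφcont hφdiff
    (hφinj.mono ball_subset_closedBall) hφim hX hβ.1 hδ.1 hHolder h𝒲
  obtain ⟨C, hC, hpoly⟩ := exists_add_one_pow_three_le (half_pos ha0)
  have hlim : Tendsto (fun j : ℕ => (1 / 2 : ℝ) ^ j) atTop (𝓝[>] 0) :=
    tendsto_nhdsWithin_iff.2 ⟨tendsto_pow_atTop_nhds_zero_of_lt_one (by norm_num) (by norm_num),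
      Eventually.of_forall fun j => by simp⟩
  obtain ⟨j₀, hj₀⟩ := eventually_atTop.1 (hlim.eventually (hdim (d + a / 2) (by linarith)))
  set F : ℕ → ℝ := fun j => ((hitSquares φ X 𝒲 j).ncard : ℝ) with hF
  have hF0 : ∀ j, 0 ≤ F j := fun j => Nat.cast_nonneg _
  have hsum : 0 ≤ ∑ j ∈ Finset.range j₀, F j := Finset.sum_nonneg fun j _ => hF0 j
  refine ⟨∑ j ∈ Finset.range j₀, F j + 2 * A * C + 1, by positivity, fun j => ?_⟩
  change F j ≤ _
  have hone : 1 ≤ (2 : ℝ) ^ ((d + a) * j) :=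
    Real.one_le_rpow one_le_two (mul_nonneg (by linarith [hd.1]) (Nat.cast_nonneg j))
  rcases lt_or_ge j j₀ with hj | hj
  · have h1 : F j ≤ ∑ j ∈ Finset.range j₀, F j :=
      Finset.single_le_sum (fun i _ => hF0 i) (Finset.mem_range.2 hj)
    have h2 : 0 ≤ 2 * A * C := by positivity
    calc F j ≤ (∑ j ∈ Finset.range j₀, F j + 2 * A * C + 1) * 1 := by linarith
      _ ≤ _ := by gcongr
  · have hv : ((1 / 2 : ℝ) ^ j) ^ (-(d + a / 2)) = 2 ^ ((d + a / 2) * j) := by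
      rw [one_div, inv_pow, ← Real.rpow_natCast, ← Real.rpow_neg (by norm_num),
        ← Real.rpow_mul (by norm_num)]
      congr 1
      ring
    have hcov := hj₀ j hj
    rw [hv] at hcov
    obtain ⟨T, hTcard, hT⟩ := exists_finset_of_coverNum_le (Real.one_le_rpow one_le_two
      (mul_nonneg (by linarith [hd.1]) (Nat.cast_nonneg j))) hcov
    have hsplit : (2 : ℝ) ^ ((d + a) * j) = 2 ^ ((d + a / 2) * j) * 2 ^ (a / 2 * j) := by
      rw [← Real.rpow_add (by norm_num)]
      congr 1
      ring
    calc F j ≤ A * T.card * ((j : ℝ) + 1) ^ 3 := hcount j T hT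
      _ ≤ A * (2 * 2 ^ ((d + a / 2) * j)) * (C * 2 ^ (a / 2 * j)) := by
        gcongr
        exact hpoly j
      _ = 2 * A * C * 2 ^ ((d + a) * j) := by rw [hsplit]; ring
      _ ≤ _ := by
        gcongr
        linarith
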